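/- Let n ≥ 1 be an integer and let f be a bounded continuous function on [0,∞) with f ∈ W²(ψ). Then ‖Ṽ_n f − f‖ ≤ (2/n)·‖D̃f‖; in particular Ṽ_n f converges to f uniformly on [0,∞) as n → ∞. -/

import Mathlib

open MeasureTheory Filter Set

/-- Baskakov basis functions `P_{n,k}(x)`, with `P_{n,k} := 0` for `k < 0`. -/
noncomputable def P (n : ℕ) (k : ℤ) (x : ℝ) : ℝ :=
  if k < 0 then 0
  else (Nat.choose (n + k.toNat - 1) k.toNat : ℝ) * x ^ k.toNat * (1 + x) ^ (-(n : ℤ) - k)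

/-- The weight `ψ(x) = x(1+x)`. -/
noncomputable def psi (x : ℝ) : ℝ := x * (1 + x)

/-- The differential operator `D̃ f = ψ f''`. -/
noncomputable def Dt (f : ℝ → ℝ) : ℝ → ℝ := fun x => psi x * deriv (deriv f) x

/-- The functionals `v_{n,k}`. -/
noncomputable def v (n k : ℕ) (f : ℝ → ℝ) : ℝ :=
  if k = 0 then f 0
  else ((n : ℝ) + 1) * ∫ t in Set.Ioi (0 : ℝ), P (n + 2) ((k : ℤ) - 1) t * f t

/-- The Goodman–Sharma–Baskakov operator `V_n`. -/
noncomputable def V (n : ℕ) (f : ℝ → ℝ) (x : ℝ) : ℝ :=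
  ∑' k : ℕ, v n k f * P n (k : ℤ) x

/-- The modified operator `Ṽ_n`. -/
noncomputable def Vt (n : ℕ) (f : ℝ → ℝ) (x : ℝ) : ℝ :=
  ∑' k : ℕ, v n k f * (P n (k : ℤ) x - (1 / (n : ℝ)) * Dt (P n (k : ℤ)) x)

/-- Supremum norm on `[0,∞)`. -/
noncomputable def supNorm (f : ℝ → ℝ) : ℝ := ⨆ x ∈ Set.Ici (0 : ℝ), |f x|

/-- `f` is bounded and continuous on `[0,∞)`. -/
def BddContOn (f : ℝ → ℝ) : Prop :=
  ContinuousOn f (Set.Ici 0) ∧ ∃ M, ∀ x ∈ Set.Ici (0 : ℝ), |f x| ≤ M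

/-- The space `W²(ψ)`: `g, g'` (locally) differentiable on `(0,∞)` and `D̃ g` bounded. -/
def MemW2 (g : ℝ → ℝ) : Prop :=
  DifferentiableOn ℝ g (Set.Ioi 0) ∧ DifferentiableOn ℝ (deriv g) (Set.Ioi 0) ∧
    ∃ M, ∀ x ∈ Set.Ioi (0 : ℝ), |Dt g x| ≤ M

/-- The space `W²₀(ψ)`: members of `W²(ψ)` with `D̃ g(x) → 0` as `x → 0⁺`. -/
def MemW20 (g : ℝ → ℝ) : Prop :=
  MemW2 g ∧ Filter.Tendsto (Dt g) (nhdsWithin 0 (Set.Ioi 0)) (nhds 0)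

/-- The K-functional `K(f,t)`. -/
noncomputable def Kfun (f : ℝ → ℝ) (t : ℝ) : ℝ :=
  sInf {a : ℝ | ∃ g : ℝ → ℝ, MemW20 g ∧ MemW2 (Dt g) ∧
    a = supNorm (fun x => f x - g x) + t * supNorm (Dt (Dt g))}

/-- The function `T_{n,k}(x)`. -/
noncomputable def T (n : ℕ) (k : ℤ) (x : ℝ) : ℝ :=
  (k : ℝ) * ((k : ℝ) - 1) * (1 + x) / x - 2 * (k : ℝ) * ((n : ℝ) + (k : ℝ))
    + ((n : ℝ) + (k : ℝ)) * ((n : ℝ) + (k : ℝ) + 1) * x / (1 + x)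

open Topology

theorem P_natCast (m k : ℕ) (x : ℝ) :
    P (m + 1) (k : ℤ) x = ((m + k).choose k : ℝ) * x ^ k / (1 + x) ^ (m + 1 + k) := by
  have h : (-((m + 1 : ℕ) : ℤ) - (k : ℤ)) = -((m + 1 + k : ℕ) : ℤ) := by push_cast; ring
  have h' : m + 1 + k - 1 = m + k := by omega
  rw [P, if_neg (by omega), Int.toNat_natCast, h, zpow_neg, zpow_natCast, h', div_eq_mul_inv]

theorem P_of_neg {n : ℕ} {k : ℤ} (hk : k < 0) (x : ℝ) : P n k x = 0 := if_pos hk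

theorem P_nonneg (n : ℕ) (k : ℤ) {x : ℝ} (hx : 0 ≤ x) : 0 ≤ P n k x := by
  unfold P
  split_ifs
  · exact le_rfl
  · positivity

theorem choose_succ_right_mul (m k : ℕ) :
    ((k : ℝ) + 1) * ((m + (k + 1)).choose (k + 1) : ℝ)
      = (m + k + 1) * ((m + k).choose k : ℝ) := by
  have h := Nat.add_one_mul_choose_eq (m + k) k
  have h' : (m + k + 1 : ℝ) * ((m + k).choose k : ℝ)
      = ((m + k + 1).choose (k + 1) : ℝ) * (k + 1) := by exact_mod_cast h
  rw [h', ← add_assoc, mul_comm]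

theorem choose_succ_left_mul (m k : ℕ) :
    ((m : ℝ) + 1) * ((m + 1 + k).choose k : ℝ) = (m + k + 1) * ((m + k).choose k : ℝ) := by
  have h := Nat.choose_mul_succ_eq (m + k) k
  rw [show m + k + 1 - k = m + 1 by omega, show m + k + 1 = m + 1 + k by omega] at h
  have h' : ((m + k).choose k : ℝ) * (m + 1 + k)
      = ((m + 1 + k).choose k : ℝ) * (m + 1) := by exact_mod_cast h
  linarith

/-- Multiplication by the variable shifts the basis functions. -/
theorem mul_P (m : ℕ) (k : ℤ) {x : ℝ} (hx : -1 < x) :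
    (m + 1) * (x * P (m + 2) k x) = (k + 1) * P (m + 1) (k + 1) x := by
  have hx' : 1 + x ≠ 0 := by linarith
  rcases lt_or_ge k 0 with hk | hk
  · rw [P_of_neg hk]
    rcases eq_or_lt_of_le (show k ≤ -1 by omega) with rfl | hk'
    · simp
    · rw [P_of_neg (by omega)]; simp
  · lift k to ℕ using hk
    rw [P_natCast (m + 1), show ((k : ℤ) + 1) = ((k + 1 : ℕ) : ℤ) by push_cast; rfl, P_natCast]
    have h1 := choose_succ_right_mul m k
    have h2 := choose_succ_left_mul m k
    have h3 : (1 + x) ^ (m + 1 + 1 + k) = (1 + x) ^ (m + 1 + (k + 1)) := by congr 1; omega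
    rw [h3, pow_succ]
    push_cast
    field_simp
    linear_combination x * x ^ k * (h2 - h1)

theorem P_succ (m : ℕ) (k : ℤ) {x : ℝ} (hx : -1 < x) :
    (m + 1) * P (m + 2) k x
      = (m + 1 + k) * P (m + 1) k x - (k + 1) * P (m + 1) (k + 1) x := by
  have hx' : 1 + x ≠ 0 := by linarith
  rw [← mul_P m k hx]
  rcases lt_or_ge k 0 with hk | hk
  · simp [P_of_neg hk]
  · lift k to ℕ using hk
    rw [P_natCast (m + 1), P_natCast]
    have h2 := choose_succ_left_mul m k
    have h3 : (1 + x) ^ (m + 1 + 1 + k) = (1 + x) ^ (m + 1 + k) * (1 + x) := by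
      rw [← pow_succ]; congr 1; omega
    rw [h3]
    push_cast
    field_simp
    linear_combination (1 + x) * x ^ k * h2

theorem psi_mul_P (m : ℕ) (k : ℤ) {x : ℝ} (hx : -1 < x) :
    psi x * ((m + 1) * (m + 2) * P (m + 3) (k - 1) x) = k * (m + 1 + k) * P (m + 1) k x := by
  have h1 := mul_P (m + 1) (k - 1) hx
  have h2 := mul_P m k hx
  have h3 := P_succ m k hx
  simp only [sub_add_cancel] at h1
  push_cast at h1
  unfold psi
  linear_combination (m + 1) * (1 + x) * h1 + k * (h2 + h3)

theorem hasDerivAt_P (m : ℕ) (k : ℤ) {x : ℝ} (hx : -1 < x) :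
    HasDerivAt (P (m + 1) k) ((m + 1) * (P (m + 2) (k - 1) x - P (m + 2) k x)) x := by
  have hx' : 1 + x ≠ 0 := by linarith
  rcases lt_or_ge k 0 with hk | hk
  · have h0 : P (m + 1) k = fun _ => 0 := funext fun y => P_of_neg hk y
    rw [h0, P_of_neg hk, P_of_neg (by omega)]
    simpa using hasDerivAt_const x (0 : ℝ)
  · lift k to ℕ using hk
    have h0 : P (m + 1) k = fun y =>
        ((m + k).choose k : ℝ) * y ^ k / (1 + y) ^ (m + 1 + k) := funext fun y => P_natCast m k y
    have hd := (((hasDerivAt_pow k x).const_mul ((m + k).choose k : ℝ)).div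
      (((hasDerivAt_id x).const_add 1).pow (m + 1 + k)) (pow_ne_zero _ hx'))
    rw [h0]
    refine hd.congr_deriv ?_
    have h2 := choose_succ_left_mul m k
    rcases k with _ | k
    · rw [P_of_neg (by simp), P_natCast (m + 1)]
      simp only [id, Pi.pow_apply, Nat.choose_zero_right, add_zero, pow_succ, Nat.add_sub_cancel]
      push_cast
      field_simp
      ring
    · rw [show ((k + 1 : ℕ) : ℤ) - 1 = (k : ℤ) by push_cast; ring, P_natCast (m + 1),
        P_natCast (m + 1)]
      have h3 := choose_succ_left_mul m k
      have h1 := choose_succ_right_mul m k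
      have e1 : m + 1 + (k + 1) - 1 = m + 1 + k := by omega
      have e3 : m + 1 + 1 + k = m + 1 + k + 1 := by omega
      have e4 : m + 1 + 1 + (k + 1) = m + 1 + k + 1 + 1 := by omega
      simp only [id, Pi.pow_apply, Nat.add_sub_cancel]
      rw [e1, e3, e4, show m + 1 + (k + 1) = m + 1 + k + 1 from rfl]
      push_cast at h1 h2 h3 ⊢
      simp only [pow_succ]
      field_simp
      linear_combination x ^ k * ((1 + x) * h1 - (1 + x) * h3 + x * h2)

theorem continuousOn_P (m : ℕ) (k : ℤ) : ContinuousOn (P (m + 1) k) (Ici 0) := fun x hx =>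
  (hasDerivAt_P m k (lt_of_lt_of_le (by norm_num) hx)).continuousAt.continuousWithinAt

theorem hasDerivAt_deriv_P (m : ℕ) (k : ℤ) {x : ℝ} (hx : -1 < x) :
    HasDerivAt (fun y => (m + 1) * (P (m + 2) (k - 1) y - P (m + 2) k y))
      ((m + 1) * (m + 2) * (P (m + 3) (k - 2) x - 2 * P (m + 3) (k - 1) x + P (m + 3) k x)) x := by
  have h1 := hasDerivAt_P (m + 1) (k - 1) hx
  have h2 := hasDerivAt_P (m + 1) k hx
  refine ((h1.sub h2).const_mul ((m : ℝ) + 1)).congr_deriv ?_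
  rw [show k - 1 - 1 = k - 2 by ring]
  push_cast
  ring

theorem Dt_P (m : ℕ) (k : ℤ) {x : ℝ} (hx : -1 < x) :
    Dt (P (m + 1) k) x = (k - 1) * (m + k) * P (m + 1) (k - 1) x
      - 2 * (k * (m + 1 + k) * P (m + 1) k x)
      + (k + 1) * (m + 2 + k) * P (m + 1) (k + 1) x := by
  have h : deriv (P (m + 1) k) =ᶠ[𝓝 x]
      fun y => (m + 1) * (P (m + 2) (k - 1) y - P (m + 2) k y) := by
    filter_upwards [Ioi_mem_nhds hx] with y hy using (hasDerivAt_P m k hy).deriv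
  rw [Dt, h.deriv_eq, (hasDerivAt_deriv_P m k hx).deriv]
  have h1 := psi_mul_P m (k - 1) hx
  have h2 := psi_mul_P m k hx
  have h3 := psi_mul_P m (k + 1) hx
  rw [show k - 1 - 1 = k - 2 by ring] at h1
  rw [show k + 1 - 1 = k by ring] at h3
  push_cast at h1 h3
  linear_combination h1 - 2 * h2 + h3

theorem P_le_const_mul (m k : ℕ) {x : ℝ} (hx : 0 ≤ x) :
    P (m + 1) (k : ℤ) x ≤ ((m + k).choose k : ℝ) * P (m + 1) 0 x := by
  have h0 := P_natCast m 0 x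
  simp only [Nat.cast_zero, add_zero, Nat.choose_zero_right, pow_zero, Nat.cast_one, mul_one] at h0
  rw [P_natCast, h0, pow_add, mul_div_assoc]
  refine mul_le_mul_of_nonneg_left ?_ (Nat.cast_nonneg _)
  rw [div_le_div_iff₀ (by positivity) (by positivity), one_mul, mul_comm]
  gcongr
  linarith

theorem tendsto_P_atTop (m : ℕ) (k : ℤ) : Tendsto (P (m + 1) k) atTop (𝓝 0) := by
  rcases lt_or_ge k 0 with hk | hk
  · rw [show P (m + 1) k = fun _ => 0 from funext fun y => P_of_neg hk y]
    exact tendsto_const_nhds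
  · lift k to ℕ using hk
    have h0 : ∀ x, P (m + 1) 0 x = ((1 + x) ^ (m + 1))⁻¹ := fun x => by
      simpa using P_natCast m 0 x
    have h1 : Tendsto (P (m + 1) 0) atTop (𝓝 0) := by
      rw [funext h0]
      exact tendsto_inv_atTop_zero.comp ((tendsto_pow_atTop (Nat.succ_ne_zero m)).comp
        (tendsto_atTop_add_const_left _ _ tendsto_id))
    have h2 := h1.const_mul ((m + k).choose k : ℝ)
    rw [mul_zero] at h2
    refine squeeze_zero' ?_ ?_ h2
    · filter_upwards [eventually_ge_atTop 0] with x hx using P_nonneg _ _ hx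
    · filter_upwards [eventually_ge_atTop 0] with x hx using P_le_const_mul m k hx

theorem aestronglyMeasurable_P (m : ℕ) (k : ℤ) :
    AEStronglyMeasurable (P (m + 1) k) (volume.restrict (Ioi 0)) :=
  ((continuousOn_P m k).mono Ioi_subset_Ici_self).aestronglyMeasurable measurableSet_Ioi

theorem integrableOn_P (m : ℕ) (k : ℤ) : IntegrableOn (P (m + 2) k) (Ioi 0) := by
  rcases lt_or_ge k 0 with hk | hk
  · rw [show P (m + 2) k = fun _ => 0 from funext fun y => P_of_neg hk y]
    exact integrableOn_zero
  · lift k to ℕ using hk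
    have h1 : IntegrableOn (fun x => (m + 1) * (P (m + 2) (0 - 1) x - P (m + 2) 0 x))
        (Ioi (0 : ℝ)) := by
      refine integrableOn_Ioi_deriv_of_nonpos' (g := P (m + 1) 0) (l := 0)
        (fun x hx => hasDerivAt_P m 0 (lt_of_lt_of_le (by norm_num) hx)) (fun x hx => ?_)
        (tendsto_P_atTop m 0)
      rw [P_of_neg (by norm_num), zero_sub]
      have := P_nonneg (m + 2) 0 (le_of_lt hx)
      nlinarith [(Nat.cast_nonneg m : (0 : ℝ) ≤ m)]
    have h2 : IntegrableOn (P (m + 2) 0) (Ioi 0) := by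
      refine IntegrableOn.congr_fun (h1.const_mul (-((m : ℝ) + 1)⁻¹)) (fun x _ => ?_)
        measurableSet_Ioi
      have : (m : ℝ) + 1 ≠ 0 := by positivity
      simp only [P_of_neg (show (0 : ℤ) - 1 < 0 by norm_num)]
      field_simp
      ring
    refine (h2.const_mul ((m + 1 + k).choose k : ℝ)).mono' (aestronglyMeasurable_P (m + 1) k) ?_
    filter_upwards [ae_restrict_mem measurableSet_Ioi] with x hx
    rw [Real.norm_of_nonneg (P_nonneg _ _ (le_of_lt hx))]
    exact P_le_const_mul (m + 1) k (le_of_lt hx)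

theorem P_natCast_zero (m : ℕ) (k : ℕ) : P (m + 1) k 0 = if k = 0 then 1 else 0 := by
  rw [P_natCast]
  split_ifs with h <;> simp [h]

theorem integral_P (m k : ℕ) : ∫ t in Ioi (0 : ℝ), P (m + 2) k t = 1 / (m + 1) := by
  have key : ∀ k : ℤ, (m + 1) * ((∫ t in Ioi (0 : ℝ), P (m + 2) (k - 1) t)
      - ∫ t in Ioi (0 : ℝ), P (m + 2) k t) = 0 - P (m + 1) k 0 := fun k => by
    rw [← integral_sub (integrableOn_P m _) (integrableOn_P m _), ← integral_const_mul]
    exact integral_Ioi_of_hasDerivAt_of_tendsto'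
      (fun x hx => hasDerivAt_P m k (lt_of_lt_of_le (by norm_num) hx))
      (((integrableOn_P m _).sub (integrableOn_P m _)).const_mul _) (tendsto_P_atTop m k)
  have hm : (m : ℝ) + 1 ≠ 0 := by positivity
  induction k with
  | zero =>
    have h := key ((0 : ℕ) : ℤ)
    have h0 : ∀ t, P (m + 2) (((0 : ℕ) : ℤ) - 1) t = 0 := fun t => P_of_neg (by simp) t
    simp only [h0, P_natCast_zero, integral_zero, if_true] at h
    field_simp
    linarith
  | succ k ih =>
    have h := key ((k + 1 : ℕ) : ℤ)
    rw [P_natCast_zero, if_neg (Nat.succ_ne_zero k),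
      show ((k + 1 : ℕ) : ℤ) - 1 = k by push_cast; ring, ih, sub_zero] at h
    have := (mul_eq_zero.1 h).resolve_left hm
    linarith

theorem integrableOn_P_mul (m : ℕ) (k : ℤ) {g : ℝ → ℝ} {B : ℝ}
    (hg : AEStronglyMeasurable g (volume.restrict (Ioi 0))) (hB : ∀ x ∈ Ioi (0 : ℝ), |g x| ≤ B) :
    IntegrableOn (fun t => P (m + 2) k t * g t) (Ioi 0) :=
  Integrable.mul_bdd (c := B) (integrableOn_P m k) hg
    ((ae_restrict_mem measurableSet_Ioi).mono hB)

theorem v_zero (n : ℕ) (f : ℝ → ℝ) : v n 0 f = f 0 := if_pos rfl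

theorem v_succ (m k : ℕ) (f : ℝ → ℝ) :
    v (m + 1) (k + 1) f = (m + 2) * ∫ t in Ioi (0 : ℝ), P (m + 3) k t * f t := by
  rw [v, if_neg (Nat.succ_ne_zero k), show ((k + 1 : ℕ) : ℤ) - 1 = k by push_cast; ring]
  push_cast
  ring_nf

theorem abs_v_le (m k : ℕ) {f g : ℝ → ℝ} (hfg : ∀ x ∈ Ici (0 : ℝ), |f x| ≤ g x)
    (hg : ∀ k : ℕ, IntegrableOn (fun t => P (m + 3) k t * g t) (Ioi 0)) :
    |v (m + 1) k f| ≤ v (m + 1) k g := by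
  rcases k with _ | k
  · rw [v_zero, v_zero]
    exact hfg 0 self_mem_Ici
  · rw [v_succ, v_succ, abs_mul, abs_of_nonneg (by positivity : (0 : ℝ) ≤ m + 2)]
    refine mul_le_mul_of_nonneg_left ?_ (by positivity)
    refine norm_integral_le_of_norm_le (f := fun t => P (m + 3) k t * f t) (hg k) ?_
    filter_upwards [ae_restrict_mem measurableSet_Ioi] with x hx
    rw [norm_mul, Real.norm_of_nonneg (P_nonneg _ _ (le_of_lt hx))]
    exact mul_le_mul_of_nonneg_left (hfg x (mem_Ici.2 (le_of_lt hx))) (P_nonneg _ _ (le_of_lt hx))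

theorem v_const (m k : ℕ) (c : ℝ) : v (m + 1) k (fun _ => c) = c := by
  rcases k with _ | k
  · rw [v_zero]
  · rw [v_succ, integral_mul_const, integral_P (m + 1)]
    push_cast
    field_simp
    ring

theorem abs_v_le_const (m k : ℕ) {f : ℝ → ℝ} {B : ℝ} (hB : ∀ x ∈ Ici (0 : ℝ), |f x| ≤ B) :
    |v (m + 1) k f| ≤ B := by
  simpa only [v_const] using abs_v_le m k hB fun k => (integrableOn_P (m + 1) k).mul_const B

theorem abs_mul_deriv_le {f : ℝ → ℝ} {M : ℝ} (h1 : DifferentiableOn ℝ f (Ioi 0))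
    (h2 : DifferentiableOn ℝ (deriv f) (Ioi 0)) (hM : ∀ x ∈ Ioi (0 : ℝ), |Dt f x| ≤ M)
    {t : ℝ} (ht : 0 ≤ t) :
    |t * deriv f t| ≤ |f (2 * t) - f t| + M * (t / (1 + t)) := by
  rcases ht.eq_or_lt with rfl | ht
  · simp
  have hM0 : 0 ≤ M := (abs_nonneg _).trans (hM t ht)
  have hpos : ∀ x ∈ Icc t (2 * t), 0 < x := fun x hx => ht.trans_le hx.1
  obtain ⟨ξ, hξ, hξ'⟩ := exists_deriv_eq_slope f (show t < 2 * t by linarith)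
    (h1.continuousOn.mono hpos) (h1.mono fun x hx => hpos x (Ioo_subset_Icc_self hx))
  have hb : ∀ x ∈ Icc t (2 * t), ‖deriv (deriv f) x‖ ≤ M / (t * (1 + t)) := fun x hx => by
    have hx0 := hpos x hx
    have h := hM x hx0
    rw [Dt, abs_mul, abs_of_pos (show 0 < psi x by unfold psi; positivity)] at h
    rw [Real.norm_eq_abs, le_div_iff₀ (by positivity), mul_comm]
    refine (mul_le_mul_of_nonneg_right ?_ (abs_nonneg _)).trans h
    unfold psi
    have := hx.1
    gcongr
  have h3 := Convex.norm_image_sub_le_of_norm_deriv_le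
    (fun x hx => (h2 x (hpos x hx)).differentiableAt (Ioi_mem_nhds (hpos x hx))) hb
    (convex_Icc t (2 * t)) (Ioo_subset_Icc_self hξ) (left_mem_Icc.2 (by linarith))
  rw [Real.norm_eq_abs, Real.norm_eq_abs] at h3
  have h4 : |t - ξ| ≤ t := by rw [abs_le]; constructor <;> linarith [hξ.1, hξ.2]
  have h5 : t * deriv f ξ = f (2 * t) - f t := by
    rw [hξ']; field_simp; ring
  calc |t * deriv f t| = |t * deriv f ξ + t * (deriv f t - deriv f ξ)| := by ring_nf
    _ ≤ |t * deriv f ξ| + |t * (deriv f t - deriv f ξ)| := abs_add_le _ _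
    _ ≤ |f (2 * t) - f t| + t * (M / (t * (1 + t)) * t) := by
      rw [h5, abs_mul t, abs_of_pos ht]
      gcongr
      exact h3.trans (by gcongr)
    _ = _ := by field_simp

theorem continuousWithinAt_mul_deriv {f : ℝ → ℝ} (hf : BddContOn f) (hfW : MemW2 f) :
    ContinuousWithinAt (fun t => t * deriv f t) (Ici 0) 0 := by
  obtain ⟨h1, h2, M, hM⟩ := hfW
  have hc := hf.1 0 self_mem_Ici
  have hc2 : Tendsto (fun t : ℝ => f (2 * t)) (𝓝[≥] 0) (𝓝 (f 0)) := by
    refine Tendsto.comp (show Tendsto f (𝓝[≥] 0) (𝓝 (f 0)) from hc) ?_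
    refine tendsto_nhdsWithin_iff.2 ⟨?_, ?_⟩
    · have : Tendsto (fun t : ℝ => 2 * t) (𝓝 0) (𝓝 (2 * 0)) := by
        exact (continuous_const.mul continuous_id).tendsto 0
      rw [mul_zero] at this
      exact this.mono_left nhdsWithin_le_nhds
    · filter_upwards [self_mem_nhdsWithin] with t ht
      exact mul_nonneg zero_le_two (mem_Ici.1 ht)
  have hr : Tendsto (fun t : ℝ => M * (t / (1 + t))) (𝓝[≥] 0) (𝓝 0) := by
    have : ContinuousAt (fun t : ℝ => M * (t / (1 + t))) 0 := by
      refine continuousAt_const.mul (continuousAt_id.div (by fun_prop) (by norm_num))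
    simpa [ContinuousAt] using this.tendsto.mono_left (nhdsWithin_le_nhds (s := Ici 0))
  have hs : Tendsto (fun t : ℝ => |f (2 * t) - f t| + M * (t / (1 + t))) (𝓝[≥] 0) (𝓝 0) := by
    simpa using (hc2.sub hc).abs.add hr
  rw [ContinuousWithinAt, zero_mul]
  refine squeeze_zero_norm' ?_ hs
  filter_upwards [self_mem_nhdsWithin] with t ht using abs_mul_deriv_le h1 h2 hM ht

theorem exists_abs_mul_deriv_le {f : ℝ → ℝ} (hf : BddContOn f) (hfW : MemW2 f) :
    ∃ C, ∀ t ∈ Ici (0 : ℝ), |t * deriv f t| ≤ C := by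
  obtain ⟨h1, h2, M, hM⟩ := hfW
  obtain ⟨_, B, hB⟩ := hf
  have hM0 : 0 ≤ M := (abs_nonneg _).trans (hM 1 (mem_Ioi.2 one_pos))
  refine ⟨B + B + M * 1, fun t ht => (abs_mul_deriv_le h1 h2 hM ht).trans ?_⟩
  have ht' : (0 : ℝ) ≤ t := ht
  gcongr
  · exact (abs_sub _ _).trans (add_le_add (hB _ (mul_nonneg zero_le_two ht')) (hB t ht))
  · rw [div_le_one (by positivity)]; linarith

theorem integral_mul_sub_mul_second_difference {μ : Measure ℝ} {a b c d : ℝ → ℝ}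
    (hd : Integrable d μ) (ha : Integrable a μ) (hb : Integrable b μ) (hc : Integrable c μ)
    (r s : ℝ) : ∫ t, r * d t - s * (a t - 2 * b t + c t) ∂μ
      = r * (∫ t, d t ∂μ) - s * ((∫ t, a t ∂μ) - 2 * (∫ t, b t ∂μ) + ∫ t, c t ∂μ) := by
  have hb2 : Integrable (fun t => 2 * b t) μ := hb.const_mul 2
  have hab : Integrable (fun t => a t - 2 * b t) μ := ha.sub hb2
  have habc : Integrable (fun t => a t - 2 * b t + c t) μ := hab.add hc
  rw [integral_sub (hd.const_mul r) (habc.const_mul s), integral_const_mul, integral_const_mul,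
    integral_add hab hc, integral_sub ha hb2, integral_const_mul]

theorem v_Dt {f : ℝ → ℝ} (hf : BddContOn f) (hfW : MemW2 f) (m k : ℕ) :
    v (m + 1) (k + 1) (Dt f) = (k + 1) * (m + 2 + k) *
      (v (m + 1) k f - 2 * v (m + 1) (k + 1) f + v (m + 1) (k + 2) f) := by
  have hcont := continuousWithinAt_mul_deriv hf hfW
  obtain ⟨C, hC⟩ := exists_abs_mul_deriv_le hf hfW
  obtain ⟨h1, h2, M, hM⟩ := hfW
  obtain ⟨hfc, B, hB⟩ := hf
  have hlt : ∀ {x : ℝ}, x ∈ Ici (0 : ℝ) → -1 < x := fun hx => lt_of_lt_of_le (by norm_num) hx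
  have hk : (k : ℝ) + 1 ≠ 0 := by positivity
  have hm : (m : ℝ) + 1 ≠ 0 := by positivity
  have hPf : ∀ t ∈ Ici (0 : ℝ), P (m + 1) (k + 1) t * deriv f t
      = (m + 1) / (k + 1) * (P (m + 2) k t * (t * deriv f t)) := fun t ht => by
    have := mul_P m k (hlt ht)
    push_cast at this
    field_simp
    linear_combination -deriv f t * this
  have hfm : AEStronglyMeasurable f (volume.restrict (Ioi 0)) :=
    (hfc.mono Ioi_subset_Ici_self).aestronglyMeasurable measurableSet_Ioi
  have hDm : AEStronglyMeasurable (Dt f) (volume.restrict (Ioi 0)) := by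
    have : Measurable psi := by unfold psi; fun_prop
    exact (this.mul (measurable_deriv _)).aestronglyMeasurable
  have hI : ∀ j : ℤ, IntegrableOn (fun t => P (m + 3) j t * f t) (Ioi 0) := fun j =>
    integrableOn_P_mul (m + 1) j hfm fun x hx => hB x (mem_Ici.2 (le_of_lt hx))
  have hID : IntegrableOn (fun t => P (m + 3) k t * Dt f t) (Ioi 0) :=
    integrableOn_P_mul (m + 1) k hDm hM
  let Q : ℝ → ℝ := fun y => (m + 1) * (P (m + 2) k y - P (m + 2) (k + 1) y)
  let F : ℝ → ℝ := fun t => (m + 1) * (m + 2) / ((k + 1) * (m + 2 + k)) * (P (m + 3) k t * Dt f t)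
    - ((m + 1) * (m + 2) * (P (m + 3) (k - 1) t * f t - 2 * (P (m + 3) k t * f t)
      + P (m + 3) (k + 1) t * f t))
  have hint : IntegrableOn F (Ioi 0) :=
    (hID.const_mul _).sub ((((hI _).sub ((hI _).const_mul _)).add (hI _)).const_mul _)
  have hF : ∫ t in Ioi (0 : ℝ), F t = 0 - (P (m + 1) (k + 1) 0 * deriv f 0 - Q 0 * f 0) := by
    refine integral_Ioi_of_hasDerivAt_of_tendsto
      (f := fun t => P (m + 1) (k + 1) t * deriv f t - Q t * f t) ?_ ?_ hint ?_
    · refine ContinuousWithinAt.sub ?_ (ContinuousWithinAt.mul ?_ (hfc 0 self_mem_Ici))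
      · exact (continuousWithinAt_const.mul
          ((continuousOn_P (m + 1) k 0 self_mem_Ici).mul hcont)).congr hPf (hPf 0 self_mem_Ici)
      · exact continuousWithinAt_const.mul ((continuousOn_P (m + 1) _ 0 self_mem_Ici).sub
          (continuousOn_P (m + 1) _ 0 self_mem_Ici))
    · intro x hx
      have hx' : x ∈ Ici (0 : ℝ) := mem_Ici.2 (le_of_lt hx)
      have d1 := hasDerivAt_P m (k + 1) (hlt hx')
      have d2 := hasDerivAt_deriv_P m (k + 1) (hlt hx')
      have d3 := ((h1 x hx).differentiableAt (Ioi_mem_nhds hx)).hasDerivAt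
      have d4 := ((h2 x hx).differentiableAt (Ioi_mem_nhds hx)).hasDerivAt
      have e := psi_mul_P m (k + 1) (hlt hx')
      rw [show (k : ℤ) + 1 - 1 = k by ring] at d1 d2 e
      rw [show (k : ℤ) + 1 - 2 = k - 1 by ring] at d2
      refine ((d1.mul d4).sub (d2.mul d3)).congr_deriv ?_
      push_cast at e
      simp only [F, Dt]
      field_simp
      linear_combination -deriv (deriv f) x * e
    · have t1 : Tendsto (fun t => P (m + 1) (k + 1) t * deriv f t) atTop (𝓝 0) := by
        have := ((tendsto_P_atTop (m + 1) k).zero_mul_isBoundedUnder_le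
          (g := fun t => t * deriv f t) ?_).const_mul ((m + 1) / (k + 1) : ℝ)
        · rw [mul_zero] at this
          refine this.congr' ?_
          filter_upwards [eventually_ge_atTop 0] with t ht using (hPf t ht).symm
        · refine isBoundedUnder_of_eventually_le (a := C) ?_
          filter_upwards [eventually_ge_atTop 0] with t ht using hC t ht
      have t2 : Tendsto Q atTop (𝓝 0) := by
        simpa using ((tendsto_P_atTop (m + 1) k).sub
          (tendsto_P_atTop (m + 1) (k + 1))).const_mul ((m : ℝ) + 1)
      have t3 : Tendsto (fun t => Q t * f t) atTop (𝓝 0) := by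
        refine t2.zero_mul_isBoundedUnder_le (isBoundedUnder_of_eventually_le (a := B) ?_)
        filter_upwards [eventually_ge_atTop 0] with t ht using hB t ht
      simpa using t1.sub t3
  have hsplit : ∫ t in Ioi (0 : ℝ), F t =
      (m + 1) * (m + 2) / ((k + 1) * (m + 2 + k)) * (∫ t in Ioi (0 : ℝ), P (m + 3) k t * Dt f t)
      - (m + 1) * (m + 2) * ((∫ t in Ioi (0 : ℝ), P (m + 3) (k - 1) t * f t)
        - 2 * (∫ t in Ioi (0 : ℝ), P (m + 3) k t * f t)
        + ∫ t in Ioi (0 : ℝ), P (m + 3) (k + 1) t * f t) := by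
    exact integral_mul_sub_mul_second_difference hID (hI _) (hI _) (hI _) _ _
  have hvk : (m + 1) * v (m + 1) k f
      = Q 0 * f 0 + (m + 1) * (m + 2) * ∫ t in Ioi (0 : ℝ), P (m + 3) (k - 1) t * f t := by
    have q1 := P_natCast_zero (m + 1) k
    have q2 := P_natCast_zero (m + 1) (k + 1)
    push_cast at q2
    simp only [Q, q1, q2]
    rcases k with _ | k
    · simp [v_zero, P_of_neg]
    · rw [v_succ, show ((k + 1 : ℕ) : ℤ) - 1 = k by push_cast; ring]
      simp
      ring
  have hP0 : P (m + 1) (k + 1) 0 = 0 := by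
    simpa using P_natCast_zero m (k + 1)
  rw [hsplit, hP0] at hF
  rw [v_succ, v_succ, v_succ]
  push_cast
  refine mul_left_cancel₀ hm ?_
  field_simp at hF
  linear_combination hF - (k + 1) * (m + 2 + k) * hvk

theorem hasSum_P (m : ℕ) {x : ℝ} (hx : 0 ≤ x) : HasSum (fun k : ℕ => P (m + 1) k x) 1 := by
  have hx1 : 0 < 1 + x := by linarith
  have hr : ‖x / (1 + x)‖ < 1 := by
    rw [Real.norm_of_nonneg (by positivity), div_lt_one hx1]; linarith
  have h := (hasSum_choose_mul_geometric_of_norm_lt_one m hr).mul_left ((1 + x) ^ (m + 1))⁻¹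
  have e : 1 - x / (1 + x) = (1 + x)⁻¹ := by field_simp; ring
  rw [e] at h
  convert! h using 1
  · funext k
    rw [P_natCast, add_comm k m, Nat.choose_symm_add, pow_add, div_pow]
    field_simp
  · rw [inv_pow, one_div, inv_inv, inv_mul_cancel₀ (by positivity)]

theorem hasSum_mul_P (m : ℕ) {x : ℝ} (hx : 0 ≤ x) :
    HasSum (fun k : ℕ => (k : ℝ) * P (m + 1) k x) ((m + 1) * x) := by
  rw [← hasSum_nat_add_iff' 1]
  convert! (hasSum_P (m + 1) hx).mul_left ((m + 1) * x) using 1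
  · funext k
    have := mul_P m k (by linarith : -1 < x)
    push_cast at this ⊢
    linarith
  · simp

theorem hasSum_mul_pred_mul_P (m : ℕ) {x : ℝ} (hx : 0 ≤ x) :
    HasSum (fun k : ℕ => (k : ℝ) * (k - 1) * P (m + 1) k x) ((m + 1) * (m + 2) * x ^ 2) := by
  rw [← hasSum_nat_add_iff' 1]
  convert! (hasSum_mul_P (m + 1) hx).mul_left ((m + 1) * x) using 1
  · funext k
    have := mul_P m k (by linarith : -1 < x)
    push_cast at this ⊢
    linear_combination -(k : ℝ) * this
  · push_cast
    simp
    ring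

theorem summable_quadratic_mul_P (m : ℕ) {x : ℝ} (hx : 0 ≤ x) :
    Summable (fun k : ℕ => (k : ℝ) * (m + 1 + k) * P (m + 1) k x) := by
  refine ((hasSum_mul_pred_mul_P m hx).summable.add
    ((hasSum_mul_P m hx).summable.mul_left ((m : ℝ) + 2))).congr fun k => ?_
  ring

theorem Summable.bounded_mul {u b : ℕ → ℝ} {B : ℝ} (hu : ∀ k, |u k| ≤ B) (hb : Summable b) :
    Summable (fun k => u k * b k) := by
  refine Summable.of_norm_bounded (hb.norm.mul_left B) fun k => ?_
  rw [norm_mul]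
  exact mul_le_mul_of_nonneg_right (hu k) (norm_nonneg _)

/-- Summation by parts, twice, for a bounded sequence against a summable one. -/
theorem hasSum_second_difference {u b D : ℕ → ℝ} {B : ℝ} (hu : ∀ k, |u k| ≤ B) (hb : Summable b)
    (hb0 : b 0 = 0) (hD0 : D 0 = b 1)
    (hD : ∀ k, D (k + 1) = b k - 2 * b (k + 1) + b (k + 2)) {s : ℝ}
    (hs : HasSum (fun k => (u k - 2 * u (k + 1) + u (k + 2)) * b (k + 1)) s) :
    HasSum (fun k => u k * D k) s := by
  obtain ⟨S, hS⟩ := Summable.bounded_mul hu hb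
  obtain ⟨p, hp⟩ := Summable.bounded_mul hu ((summable_nat_add_iff 1).2 hb)
  obtain ⟨q, hq⟩ := Summable.bounded_mul (fun k => hu (k + 1)) hb
  have hS1 := (hasSum_nat_add_iff' 1).2 hS
  have hp1 := (hasSum_nat_add_iff' 1).2 hp
  have hq1 := (hasSum_nat_add_iff' 1).2 hq
  simp only [Finset.sum_range_one, hb0, mul_zero, sub_zero, zero_add] at hS1 hp1 hq1
  have e : s = p - 2 * S + q := by
    refine hs.unique (((hp.sub (hS1.mul_left 2)).add hq1).congr_fun ?_)
    intro k
    ring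
  rw [← hasSum_nat_add_iff' 1]
  simp only [Finset.sum_range_one, hD0]
  rw [show s - u 0 * b 1 = q - 2 * S + (p - u 0 * b 1) by rw [e]; ring]
  refine ((hq.sub (hS1.mul_left 2)).add hp1).congr_fun fun k => ?_
  simp only [hD]
  ring

theorem abs_tsum_mul_P_le (m : ℕ) {x : ℝ} (hx : 0 ≤ x) {u : ℕ → ℝ} {S : ℝ}
    (hu : ∀ k, |u k| ≤ S) : |∑' k : ℕ, u k * P (m + 1) k x| ≤ S := by
  have h := (hasSum_P m hx).mul_left S
  rw [mul_one] at h
  refine tsum_of_norm_bounded (f := fun k : ℕ => u k * P (m + 1) k x) h fun k => ?_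
  rw [norm_mul, Real.norm_of_nonneg (P_nonneg _ _ hx)]
  exact mul_le_mul_of_nonneg_right (hu k) (P_nonneg _ _ hx)

theorem Dt_zero (f : ℝ → ℝ) : Dt f 0 = 0 := by simp [Dt, psi]

theorem MemW2.exists_abs_Dt_le {f : ℝ → ℝ} (hfW : MemW2 f) :
    ∃ M, ∀ x ∈ Ici (0 : ℝ), |Dt f x| ≤ M := by
  obtain ⟨_, _, M, hM⟩ := hfW
  refine ⟨M, fun x hx => ?_⟩
  rcases (mem_Ici.1 hx).eq_or_lt with rfl | hx
  · rw [Dt_zero, abs_zero]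
    exact (abs_nonneg _).trans (hM 1 (mem_Ioi.2 one_pos))
  · exact hM x hx

theorem hasSum_V {f : ℝ → ℝ} {B : ℝ} (hB : ∀ x ∈ Ici (0 : ℝ), |f x| ≤ B) (m : ℕ)
    {x : ℝ} (hx : 0 ≤ x) : HasSum (fun k : ℕ => v (m + 1) k f * P (m + 1) k x) (V (m + 1) f x) :=
  (Summable.bounded_mul (fun k => abs_v_le_const m k hB) (hasSum_P m hx).summable).hasSum

/-- The operators `V` and `D̃` commute on `W²(ψ)`. -/
theorem hasSum_v_mul_Dt_P {f : ℝ → ℝ} (hf : BddContOn f) (hfW : MemW2 f) (m : ℕ)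
    {x : ℝ} (hx : 0 ≤ x) :
    HasSum (fun k : ℕ => v (m + 1) k f * Dt (P (m + 1) k) x) (V (m + 1) (Dt f) x) := by
  obtain ⟨B, hB⟩ := hf.2
  obtain ⟨M, hM⟩ := hfW.exists_abs_Dt_le
  have hx1 : -1 < x := by linarith
  refine hasSum_second_difference (fun k => abs_v_le_const m k hB)
    (summable_quadratic_mul_P m hx) (by simp) ?_ (fun k => ?_) ?_
  · have := Dt_P m 0 hx1
    rw [P_of_neg (by norm_num)] at this
    simp only [Nat.cast_zero, this]
    push_cast
    ring
  · have := Dt_P m (k + 1) hx1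
    rw [show (k : ℤ) + 1 - 1 = k by ring, show (k : ℤ) + 1 + 1 = k + 2 by ring] at this
    push_cast at this ⊢
    rw [this]
    ring
  · have h := (hasSum_nat_add_iff' 1).2 (hasSum_V hM m hx)
    simp only [Finset.sum_range_one, v_zero, Dt_zero, zero_mul, sub_zero] at h
    refine h.congr_fun fun k => ?_
    rw [v_Dt hf hfW]
    push_cast
    ring

theorem Vt_eq {f : ℝ → ℝ} (hf : BddContOn f) (hfW : MemW2 f) (m : ℕ) {x : ℝ} (hx : 0 ≤ x) :
    Vt (m + 1) f x = V (m + 1) f x - 1 / (m + 1) * V (m + 1) (Dt f) x := by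
  obtain ⟨B, hB⟩ := hf.2
  refine HasSum.tsum_eq (((hasSum_V hB m hx).sub
    ((hasSum_v_mul_Dt_P hf hfW m hx).mul_left (1 / ((m : ℝ) + 1)))).congr_fun fun k => ?_)
  push_cast
  ring

theorem v_succ_left {f : ℝ → ℝ} (hf : BddContOn f) (m k : ℕ) :
    (m + 2) * v (m + 2) k f = (m + 2 + k) * v (m + 1) k f - k * v (m + 1) (k + 1) f := by
  obtain ⟨hfc, B, hB⟩ := hf
  rcases k with _ | k
  · simp [v_zero]
  · have hfm : AEStronglyMeasurable f (volume.restrict (Ioi 0)) :=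
      (hfc.mono Ioi_subset_Ici_self).aestronglyMeasurable measurableSet_Ioi
    have hI : ∀ j : ℤ, IntegrableOn (fun t => P (m + 3) j t * f t) (Ioi 0) := fun j =>
      integrableOn_P_mul (m + 1) j hfm fun x hx => hB x (mem_Ici.2 (le_of_lt hx))
    have h : (m + 3) * ∫ t in Ioi (0 : ℝ), P (m + 4) k t * f t
        = (m + 3 + k) * (∫ t in Ioi (0 : ℝ), P (m + 3) k t * f t)
          - (k + 1) * ∫ t in Ioi (0 : ℝ), P (m + 3) (k + 1) t * f t := by
      rw [← integral_const_mul, ← integral_const_mul, ← integral_const_mul,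
        ← integral_sub ((hI _).const_mul _) ((hI _).const_mul _)]
      refine setIntegral_congr_fun measurableSet_Ioi fun t ht => ?_
      have := P_succ (m + 2) k (show -1 < t by linarith [mem_Ioi.1 ht])
      push_cast at this
      linear_combination f t * this
    rw [v_succ, v_succ, v_succ]
    push_cast
    linear_combination (m + 2) * h

theorem V_succ {f : ℝ → ℝ} (hf : BddContOn f) (hfW : MemW2 f) (m : ℕ) {x : ℝ} (hx : 0 ≤ x) :
    V (m + 2) f x = V (m + 1) f x - 1 / ((m + 1) * (m + 2)) * V (m + 1) (Dt f) x := by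
  obtain ⟨B, hB⟩ := hf.2
  obtain ⟨M, hM⟩ := hfW.exists_abs_Dt_le
  have hz : ∀ k, |v (m + 2) k f| ≤ B := fun k => abs_v_le_const (m + 1) k hB
  have hm : (m : ℝ) + 1 ≠ 0 := by positivity
  obtain ⟨a, ha⟩ := Summable.bounded_mul hz
    (((hasSum_P m hx).summable.mul_left ((m : ℝ) + 1)).add (hasSum_mul_P m hx).summable)
  obtain ⟨c, hc⟩ := Summable.bounded_mul (fun k => hz (k - 1)) (hasSum_mul_P m hx).summable
  have hc1 := (hasSum_nat_add_iff' 1).2 hc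
  simp only [Finset.sum_range_one, Nat.cast_zero, zero_mul, mul_zero, sub_zero,
    Nat.add_sub_cancel] at hc1
  have ha' : HasSum (fun k : ℕ => v (m + 2) k f * ((m + 1 + k) * P (m + 1) k x)) a :=
    ha.congr_fun fun k => by ring
  have h1 : (m + 1) * V (m + 2) f x = a - c := by
    refine ((hasSum_V hB (m + 1) hx).mul_left ((m : ℝ) + 1)).unique
      ((ha'.sub hc1).congr_fun fun k => ?_)
    have := P_succ m k (by linarith : -1 < x)
    push_cast at this ⊢
    linear_combination v (m + 2) k f * this
  have h2 : (m + 1) * (V (m + 1) f x - 1 / ((m + 1) * (m + 2)) * V (m + 1) (Dt f) x)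
      = a - c := by
    refine (((hasSum_V hB m hx).sub ((hasSum_V hM m hx).mul_left
      (1 / (((m : ℝ) + 1) * (m + 2))))).mul_left ((m : ℝ) + 1)).unique
      ((ha'.sub hc).congr_fun fun k => ?_)
    rcases k with _ | k
    · simp only [v_zero, Dt_zero]
      simp
      ring
    · have r1 := v_succ_left hf m (k + 1)
      have r2 := v_succ_left hf m k
      rw [v_Dt hf hfW]
      simp only [Nat.add_sub_cancel]
      push_cast at r1 r2 ⊢
      field_simp
      linear_combination (k + 1) * P (m + 1) (k + 1) x * r2
        - (m + 2 + k) * P (m + 1) (k + 1) x * r1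
  exact mul_left_cancel₀ hm (h1.trans h2.symm)

theorem abs_V_sub_V_le {f : ℝ → ℝ} (hf : BddContOn f) (hfW : MemW2 f) {S : ℝ}
    (hS : ∀ x ∈ Ici (0 : ℝ), |Dt f x| ≤ S) (m j : ℕ) {x : ℝ} (hx : 0 ≤ x) :
    |V (m + 1) f x - V (m + j + 1) f x| ≤ S * (1 / (m + 1) - 1 / (m + j + 1)) := by
  induction j with
  | zero => simp
  | succ j ih =>
    have h1 := V_succ hf hfW (m + j) hx
    have h2 : |V (m + j + 1) (Dt f) x| ≤ S :=
      abs_tsum_mul_P_le (m + j) hx fun k => abs_v_le_const (m + j) k hS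
    have e : V (m + 1) f x - V (m + (j + 1) + 1) f x = (V (m + 1) f x - V (m + j + 1) f x)
        + 1 / ((m + j + 1) * (m + j + 2)) * V (m + j + 1) (Dt f) x := by
      rw [show m + (j + 1) + 1 = m + j + 2 by ring, h1]
      push_cast
      ring
    have h3 : |1 / (((m : ℝ) + j + 1) * (m + j + 2)) * V (m + j + 1) (Dt f) x|
        ≤ 1 / (((m : ℝ) + j + 1) * (m + j + 2)) * S := by
      rw [abs_mul, abs_of_nonneg (by positivity)]
      exact mul_le_mul_of_nonneg_left h2 (by positivity)
    rw [e]
    refine (abs_add_le _ _).trans ((add_le_add ih h3).trans_eq ?_)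
    push_cast
    field_simp
    ring

theorem quadratic_mul_P (m k : ℕ) (a b c : ℝ) {t : ℝ} (ht : 0 < t) :
    P (m + 4) k t * (a + b * t + c * t ^ 2) = a * P (m + 4) k t
      + b * ((k + 1) / (m + 3)) * P (m + 3) (k + 1 : ℕ) t
      + c * ((k + 1) * (k + 2) / ((m + 3) * (m + 2))) * P (m + 2) (k + 2 : ℕ) t := by
  have h1 := mul_P (m + 2) k (by linarith : -1 < t)
  have h2 := mul_P (m + 1) (k + 1) (by linarith : -1 < t)
  rw [show (k : ℤ) + 1 + 1 = k + 2 by ring] at h2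
  push_cast at h1 h2 ⊢
  field_simp
  linear_combination (b * (m + 2) + c * t * (m + 2)) * h1 + c * (k + 1) * h2

theorem integrableOn_P_mul_quadratic (m k : ℕ) (a b c : ℝ) :
    IntegrableOn (fun t => P (m + 4) k t * (a + b * t + c * t ^ 2)) (Ioi 0) := by
  refine IntegrableOn.congr_fun ((((integrableOn_P (m + 2) k).const_mul a).add
    ((integrableOn_P (m + 1) (k + 1 : ℕ)).const_mul (b * ((k + 1) / (m + 3))))).add
    ((integrableOn_P m (k + 2 : ℕ)).const_mul (c * ((k + 1) * (k + 2) / ((m + 3) * (m + 2))))))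
    (fun t ht => (quadratic_mul_P m k a b c ht).symm) measurableSet_Ioi

theorem v_quadratic (m k : ℕ) (a b c : ℝ) : v (m + 2) k (fun t => a + b * t + c * t ^ 2)
      = a + b * (k / (m + 2)) + c * (k * (k + 1) / ((m + 2) * (m + 1))) := by
  rcases k with _ | k
  · simp [v_zero]
  · have i1 := (integrableOn_P (m + 2) k).const_mul a
    have i2 := (integrableOn_P (m + 1) (k + 1 : ℕ)).const_mul (b * ((k + 1) / (m + 3)))
    have i3 := (integrableOn_P m (k + 2 : ℕ)).const_mul
      (c * ((k + 1) * (k + 2) / ((m + 3) * (m + 2))))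
    have i12 : IntegrableOn (fun t => a * P (m + 4) k t
      + b * ((k + 1) / (m + 3)) * P (m + 3) (k + 1 : ℕ) t) (Ioi 0) := i1.add i2
    rw [v_succ, setIntegral_congr_fun measurableSet_Ioi
      (fun t ht => quadratic_mul_P m k a b c ht), integral_add i12 i3, integral_add i1 i2,
      integral_const_mul, integral_const_mul, integral_const_mul, integral_P (m + 2),
      integral_P (m + 1), integral_P m]
    push_cast
    field_simp
    ring

theorem v_sub_const {f : ℝ → ℝ} (hf : BddContOn f) (m k : ℕ) (c : ℝ) :
    v (m + 1) k (fun t => f t - c) = v (m + 1) k f - c := by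
  obtain ⟨hfc, B, hB⟩ := hf
  rcases k with _ | k
  · simp [v_zero]
  · have hfm : AEStronglyMeasurable f (volume.restrict (Ioi 0)) :=
      (hfc.mono Ioi_subset_Ici_self).aestronglyMeasurable measurableSet_Ioi
    have hI : IntegrableOn (fun t => P (m + 3) k t * f t) (Ioi 0) :=
      integrableOn_P_mul (m + 1) k hfm fun x hx => hB x (mem_Ici.2 (le_of_lt hx))
    have hc := v_const m (k + 1) c
    rw [v_succ] at hc ⊢
    rw [v_succ]
    simp only [mul_sub]
    rw [integral_sub hI ((integrableOn_P (m + 1) k).mul_const c), mul_sub, hc]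

theorem abs_V_sub_le {f : ℝ → ℝ} (hf : BddContOn f) {x ε C : ℝ} (hx : 0 ≤ x)
    (h : ∀ t ∈ Ici (0 : ℝ), |f t - f x| ≤ ε + C * (t - x) ^ 2) (m : ℕ) :
    |V (m + 2) f x - f x| ≤ ε + 2 * C * (x * (1 + x)) / (m + 1) := by
  obtain ⟨B, hB⟩ := hf.2
  have hv : ∀ k, |v (m + 2) k f - f x| ≤ (ε + C * x ^ 2) + (-2 * C * x) * (k / (m + 2))
      + C * (k * (k + 1) / ((m + 2) * (m + 1))) := fun k => by
    rw [← v_quadratic, ← v_sub_const hf (m + 1)]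
    refine abs_v_le (m + 1) k (fun t ht => (h t ht).trans_eq (by ring))
      fun k => integrableOn_P_mul_quadratic m k _ _ _
  have s0 := hasSum_P (m + 1) hx
  have s1 := hasSum_mul_P (m + 1) hx
  have s2 := hasSum_mul_pred_mul_P (m + 1) hx
  have hm1 : (m : ℝ) + 1 ≠ 0 := by positivity
  have hV : V (m + 2) f x - f x = ∑' k : ℕ, (v (m + 2) k f - f x) * P (m + 2) k x := by
    refine (HasSum.tsum_eq ?_).symm
    have := (hasSum_V hB (m + 1) hx).sub (s0.mul_left (f x))
    rw [mul_one] at this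
    exact this.congr_fun fun k => by ring
  have hR : HasSum (fun k : ℕ => ((ε + C * x ^ 2) + (-2 * C * x) * (k / (m + 2))
      + C * (k * (k + 1) / ((m + 2) * (m + 1)))) * P (m + 2) k x)
      (ε + 2 * C * (x * (1 + x)) / (m + 1)) := by
    have := ((s0.mul_left (ε + C * x ^ 2)).add (s1.mul_left (-2 * C * x / (m + 2)))).add
      ((s2.add (s1.mul_left 2)).mul_left (C / ((m + 2) * (m + 1))))
    convert! this using 1
    · funext k
      field_simp
      ring
    · push_cast
      field_simp
      ring
  rw [hV]
  refine tsum_of_norm_bounded (f := fun k : ℕ => (v (m + 2) k f - f x) * P (m + 2) k x)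
    hR fun k => ?_
  rw [norm_mul, Real.norm_of_nonneg (P_nonneg _ _ hx)]
  exact mul_le_mul_of_nonneg_right (hv k) (P_nonneg _ _ hx)

theorem exists_abs_sub_le_add_mul_sq {f : ℝ → ℝ} (hf : BddContOn f) {x ε : ℝ} (hx : 0 ≤ x)
    (hε : 0 < ε) : ∃ C, ∀ t ∈ Ici (0 : ℝ), |f t - f x| ≤ ε + C * (t - x) ^ 2 := by
  obtain ⟨hfc, B, hB⟩ := hf
  have hB0 : 0 ≤ B := (abs_nonneg _).trans (hB x hx)
  obtain ⟨δ, hδ, h⟩ := Metric.continuousOn_iff.1 hfc x hx ε hε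
  refine ⟨(B + B) / δ ^ 2, fun t ht => ?_⟩
  rcases lt_or_ge |t - x| δ with hlt | hge
  · have h1 := (h t ht hlt).le
    rw [Real.dist_eq] at h1
    have : 0 ≤ (B + B) / δ ^ 2 * (t - x) ^ 2 := by positivity
    linarith
  · have h1 : |f t - f x| ≤ B + B := (abs_sub _ _).trans (add_le_add (hB t ht) (hB x hx))
    have h2 : δ ^ 2 ≤ (t - x) ^ 2 := by
      rw [← sq_abs (t - x)]; gcongr
    have h3 : B + B ≤ (B + B) / δ ^ 2 * (t - x) ^ 2 := by
      rw [div_mul_eq_mul_div, le_div_iff₀ (by positivity)]; gcongr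
    linarith

theorem tendsto_V {f : ℝ → ℝ} (hf : BddContOn f) {x : ℝ} (hx : 0 ≤ x) :
    Tendsto (fun n => V n f x) atTop (𝓝 (f x)) := by
  rw [← tendsto_add_atTop_iff_nat 2, Metric.tendsto_atTop']
  intro ε hε
  obtain ⟨C, hC⟩ := exists_abs_sub_le_add_mul_sq hf hx (half_pos hε)
  have h0 : Tendsto (fun m : ℕ => 2 * C * (x * (1 + x)) / ((m : ℝ) + 1)) atTop (𝓝 0) := by
    have := (tendsto_one_div_add_atTop_nhds_zero_nat (𝕜 := ℝ)).const_mul (2 * C * (x * (1 + x)))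
    simpa [div_eq_mul_inv] using this
  obtain ⟨N, hN⟩ := eventually_atTop.1 (h0.eventually_lt_const (half_pos hε))
  refine ⟨N, fun m hm => ?_⟩
  rw [Real.dist_eq]
  linarith [abs_V_sub_le hf hx hC m, hN m hm.le]

theorem abs_V_sub_le_div {f : ℝ → ℝ} (hf : BddContOn f) (hfW : MemW2 f) {S : ℝ}
    (hS : ∀ x ∈ Ici (0 : ℝ), |Dt f x| ≤ S) (m : ℕ) {x : ℝ} (hx : 0 ≤ x) :
    |V (m + 1) f x - f x| ≤ S / (m + 1) := by
  have hS0 : 0 ≤ S := (abs_nonneg _).trans (hS x hx)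
  have ht : Tendsto (fun j => |V (m + 1) f x - V (m + j + 1) f x|) atTop
      (𝓝 |V (m + 1) f x - f x|) := by
    refine (tendsto_const_nhds.sub ((tendsto_V hf hx).comp ?_)).abs
    exact tendsto_atTop_mono (fun j => show j ≤ m + j + 1 by omega) tendsto_id
  refine le_of_tendsto' ht fun j => (abs_V_sub_V_le hf hfW hS m j hx).trans ?_
  rw [div_eq_mul_one_div S]
  have : (0 : ℝ) ≤ 1 / (m + j + 1) := by positivity
  exact mul_le_mul_of_nonneg_left (sub_le_self _ this) hS0

theorem abs_Vt_sub_le {f : ℝ → ℝ} (hf : BddContOn f) (hfW : MemW2 f) {S : ℝ}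
    (hS : ∀ x ∈ Ici (0 : ℝ), |Dt f x| ≤ S) {n : ℕ} (hn : 1 ≤ n) {x : ℝ} (hx : 0 ≤ x) :
    |Vt n f x - f x| ≤ 2 / n * S := by
  obtain ⟨m, rfl⟩ := Nat.exists_eq_add_of_le' hn
  have h1 := abs_V_sub_le_div hf hfW hS m hx
  have h2 : |V (m + 1) (Dt f) x| ≤ S := abs_tsum_mul_P_le m hx fun k => abs_v_le_const m k hS
  have h3 : |1 / ((m : ℝ) + 1) * V (m + 1) (Dt f) x| ≤ 1 / ((m : ℝ) + 1) * S := by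
    rw [abs_mul, abs_of_nonneg (by positivity)]
    exact mul_le_mul_of_nonneg_left h2 (by positivity)
  rw [Vt_eq hf hfW m hx, sub_right_comm]
  refine (abs_sub _ _).trans ((add_le_add h1 h3).trans_eq ?_)
  push_cast
  ring

theorem supNorm_le {g : ℝ → ℝ} {c : ℝ} (hc : 0 ≤ c) (h : ∀ x ∈ Ici (0 : ℝ), |g x| ≤ c) :
    supNorm g ≤ c :=
  Real.iSup_le (fun x => Real.iSup_le (fun hx => h x hx) hc) hc

theorem abs_le_supNorm {g : ℝ → ℝ} {M : ℝ} (hM : ∀ x ∈ Ici (0 : ℝ), |g x| ≤ M) {x : ℝ}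
    (hx : x ∈ Ici (0 : ℝ)) : |g x| ≤ supNorm g := by
  have hM0 : 0 ≤ M := (abs_nonneg _).trans (hM x hx)
  have hb : BddAbove (range fun y => ⨆ _ : y ∈ Ici (0 : ℝ), |g y|) :=
    ⟨M, by rintro _ ⟨y, rfl⟩; exact Real.iSup_le (fun hy => hM y hy) hM0⟩
  have h := le_ciSup hb x
  rwa [ciSup_pos hx] at h

theorem Vt_approx_and_convergence (f : ℝ → ℝ) (hf : BddContOn f) (hfW : MemW2 f) :
    (∀ n : ℕ, 1 ≤ n →
      supNorm (fun x => Vt n f x - f x) ≤ (2 / (n : ℝ)) * supNorm (Dt f)) ∧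
    TendstoUniformlyOn (fun n x => Vt n f x) f Filter.atTop (Set.Ici 0) := by
  obtain ⟨M, hM⟩ := hfW.exists_abs_Dt_le
  have hS : ∀ x ∈ Ici (0 : ℝ), |Dt f x| ≤ supNorm (Dt f) := fun x hx => abs_le_supNorm hM hx
  have hS0 : 0 ≤ supNorm (Dt f) := (abs_nonneg _).trans (hS 0 self_mem_Ici)
  refine ⟨fun n hn => supNorm_le (by positivity) fun x hx => abs_Vt_sub_le hf hfW hS hn hx, ?_⟩
  rw [Metric.tendstoUniformlyOn_iff]
  intro ε hε
  have h0 : Tendsto (fun n : ℕ => 2 / (n : ℝ) * supNorm (Dt f)) atTop (𝓝 0) := by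
    simpa using (tendsto_const_div_atTop_nhds_zero_nat (2 : ℝ)).mul_const (supNorm (Dt f))
  filter_upwards [h0.eventually_lt_const hε, eventually_ge_atTop 1] with n hn hn1 x hx
  rw [dist_comm, Real.dist_eq]
  exact (abs_Vt_sub_le hf hfW hS hn1 hx).trans_lt hn
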